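/- Suppose m ≤ n ≤ d < m+n and set d' = m+n−d and σ = (d'−1)n + d. Then u_d(x,T) = (−1)^{σ} · V(A) · V(B) · ( F_{d'−1}(x)f(x) + T·G_{d'−1}(x)g(x) ) · (T−1)^{d'−1} in K[x,T]. -/

import Mathlib

open Polynomial Finset

variable {K : Type*} [Field K]

/-- Sylvester's double sum `Sylv^{p,q}(A,B;x)`. -/
noncomputable def sylvSum {m n : ℕ} (A : Fin m → K) (B : Fin n → K) (p q : ℕ) :
    Polynomial K :=
  ∑ Sa ∈ Finset.powersetCard p (Finset.univ : Finset (Fin m)),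
    ∑ Sb ∈ Finset.powersetCard q (Finset.univ : Finset (Fin n)),
      (∏ i ∈ Sa, (X - C (A i))) * (∏ j ∈ Sb, (X - C (B j))) *
        C (((∏ i ∈ Sa, ∏ j ∈ Sb, (A i - B j)) *
            (∏ i ∈ Saᶜ, ∏ j ∈ Sbᶜ, (A i - B j))) /
           ((∏ i ∈ Sa, ∏ i' ∈ Saᶜ, (A i - A i')) *
            (∏ j ∈ Sb, ∏ j' ∈ Sbᶜ, (B j - B j'))))

/-- The matrix whose determinant defines the `k`-th subresultant of `f` (of degree `m`) and
`g` (of degree `n`), with a general last column given by `wf` on the `f`-rows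
and `wg` on the `g`-rows. -/
noncomputable def sresMatGen (m n k : ℕ) (f g : Polynomial K) (wf wg : ℕ → Polynomial K) :
    Matrix (Fin ((n - k) + (m - k))) (Fin ((n - k) + (m - k))) (Polynomial K) :=
  Matrix.of fun r c =>
    if (r : ℕ) < n - k then
      if (c : ℕ) = (n - k) + (m - k) - 1 then wf (r : ℕ)
      else if (c : ℕ) ≤ m + (r : ℕ) then C (f.coeff (m + (r : ℕ) - (c : ℕ))) else 0
    else
      if (c : ℕ) = (n - k) + (m - k) - 1 then wg ((r : ℕ) - (n - k))
      else if (c : ℕ) ≤ n + ((r : ℕ) - (n - k)) then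
        C (g.coeff (n + ((r : ℕ) - (n - k)) - (c : ℕ)))
      else 0

/-- The `k`-th subresultant `Sres_k(f,g)`. -/
noncomputable def sres (m n k : ℕ) (f g : Polynomial K) : Polynomial K :=
  (sresMatGen m n k f g (fun i => X ^ (n - k - 1 - i) * f)
    (fun i => X ^ (m - k - 1 - i) * g)).det

/-- The polynomial `F_k`: the last column is replaced by `(x^{n-k-1},…,x^0,0,…,0)ᵀ`. -/
noncomputable def sresF (m n k : ℕ) (f g : Polynomial K) : Polynomial K :=
  (sresMatGen m n k f g (fun i => X ^ (n - k - 1 - i)) (fun _ => 0)).det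

/-- The polynomial `G_k`: the last column is replaced by `(0,…,0,x^{m-k-1},…,x^0)ᵀ`. -/
noncomputable def sresG (m n k : ℕ) (f g : Polynomial K) : Polynomial K :=
  (sresMatGen m n k f g (fun _ => 0) (fun i => X ^ (m - k - 1 - i))).det

/-- The `k`-th scalar subresultant `Δ_k(f,g)`, with the convention `Δ_m(f,g) = 1`
when `m = n`. -/
noncomputable def sresDelta (m n k : ℕ) (f g : Polynomial K) : K :=
  if m = n ∧ k = m then 1 else (sres m n k f g).coeff k

/-- The Vandermonde determinant `V(Γ)` of a list `Γ`. -/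
def vand {u : ℕ} (Γ : Fin u → K) : K :=
  ∏ i : Fin u, ∏ j ∈ Finset.Ioi i, (Γ j - Γ i)

/-- The matrix `U_d(x,T)`, viewed over `(K[x])[T]`: the outer variable `X` is `T`, and
the inner variable is `x`.  Its first `m+n-d` rows are `[⟨1,B⟩_{d'} | ⟨T,A⟩_{d'}]` and its
last `d` rows are `[⟨x-t,B⟩_d | ⟨x-t,A⟩_d]`. -/
noncomputable def sylvU {m n : ℕ} (A : Fin m → K) (B : Fin n → K) (d : ℕ) :
    Matrix (Fin (m + n)) (Fin (m + n)) (Polynomial (Polynomial K)) :=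
  Matrix.of fun r c =>
    if (r : ℕ) < m + n - d then
      if h : (c : ℕ) < n then C (C (B ⟨c, h⟩ ^ (r : ℕ)))
      else X * C (C (A ⟨(c : ℕ) - n, by have := c.isLt; omega⟩ ^ (r : ℕ)))
    else
      if h : (c : ℕ) < n then
        C ((C (B ⟨c, h⟩)) ^ ((r : ℕ) - (m + n - d)) * (X - C (B ⟨c, h⟩)))
      else
        C ((C (A ⟨(c : ℕ) - n, by have := c.isLt; omega⟩)) ^ ((r : ℕ) - (m + n - d)) *
           (X - C (A ⟨(c : ℕ) - n, by have := c.isLt; omega⟩)))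

/-- The `(m+n+1)`-square matrix over `K[T]` whose first `m+n-d` rows are
`[⟨1,B⟩_{d'} | ⟨T,A⟩_{d'} | 0]` and whose last `d+1` rows are
`[⟨1,B⟩_{d+1} | ⟨1,A⟩_{d+1} | e]`, where the last column vector `e` has a single
entry `1` in (0-based) position `e₀` of the bottom block. -/
noncomputable def sylvM {m n : ℕ} (A : Fin m → K) (B : Fin n → K) (d e₀ : ℕ) :
    Matrix (Fin (m + n + 1)) (Fin (m + n + 1)) (Polynomial K) :=
  Matrix.of fun r c =>
    if (r : ℕ) < m + n - d then
      if h : (c : ℕ) < n then C (B ⟨c, h⟩ ^ (r : ℕ))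
      else if h2 : (c : ℕ) < n + m then X * C (A ⟨(c : ℕ) - n, by omega⟩ ^ (r : ℕ))
      else 0
    else
      if h : (c : ℕ) < n then C (B ⟨c, h⟩ ^ ((r : ℕ) - (m + n - d)))
      else if h2 : (c : ℕ) < n + m then
        C (A ⟨(c : ℕ) - n, by omega⟩ ^ ((r : ℕ) - (m + n - d)))
      else if (r : ℕ) - (m + n - d) = e₀ then 1 else 0

/-- The determinant of the upper left `N × N` corner of an infinite array. -/
def cornerDet {R : Type*} [CommRing R] (N : ℕ) (M : ℕ → ℕ → R) : R :=
  (Matrix.of fun i j : Fin N => M i j).det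

section CornerDet

variable {R : Type*} [CommRing R]

theorem cornerDet_congr {N : ℕ} {M M' : ℕ → ℕ → R}
    (h : ∀ i < N, ∀ j < N, M i j = M' i j) : cornerDet N M = cornerDet N M' := by
  unfold cornerDet
  congr 1
  ext i j
  exact h i i.2 j j.2

theorem cornerDet_transpose (N : ℕ) (M : ℕ → ℕ → R) :
    cornerDet N (fun i j => M j i) = cornerDet N M := by
  unfold cornerDet
  rw [← Matrix.det_transpose]
  rfl

theorem cornerDet_map {S : Type*} [CommRing S] (φ : R →+* S) (N : ℕ) (M : ℕ → ℕ → R) :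
    φ (cornerDet N M) = cornerDet N (fun i j => φ (M i j)) := by
  unfold cornerDet
  rw [RingHom.map_det]
  rfl

theorem cornerDet_mul (N : ℕ) (L M : ℕ → ℕ → R) :
    cornerDet N L * cornerDet N M =
      cornerDet N (fun i j => ∑ l ∈ range N, L i l * M l j) := by
  unfold cornerDet
  rw [← Matrix.det_mul]
  congr 1
  ext i j
  simp [Matrix.mul_apply, Finset.sum_range]

theorem cornerDet_lower {N : ℕ} {M : ℕ → ℕ → R}
    (h : ∀ i < N, ∀ j < N, i < j → M i j = 0) (h1 : ∀ i < N, M i i = 1) :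
    cornerDet N M = 1 := by
  unfold cornerDet
  rw [Matrix.det_of_isLowerTriangular]
  · exact Finset.prod_eq_one fun i _ => h1 i i.2
  · intro i j hij
    exact h i i.2 j j.2 hij

theorem cornerDet_upper {N : ℕ} {M : ℕ → ℕ → R}
    (h : ∀ i < N, ∀ j < N, j < i → M i j = 0) (h1 : ∀ i < N, M i i = 1) :
    cornerDet N M = 1 := by
  rw [← cornerDet_transpose]
  exact cornerDet_lower (fun i hi j hj hij => h j hj i hi hij) h1

theorem cornerDet_block_lower (a b : ℕ) (M : ℕ → ℕ → R)
    (h : ∀ i < a, ∀ j < b, M i (a + j) = 0) :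
    cornerDet (a + b) M = cornerDet a M * cornerDet b (fun i j => M (a + i) (a + j)) := by
  unfold cornerDet
  rw [← Matrix.det_submatrix_equiv_self finSumFinEquiv, ← Matrix.det_fromBlocks_zero₁₂ _
    (Matrix.of fun (i : Fin b) (j : Fin a) => M (a + i) j) _]
  congr 1
  ext (i | i) (j | j) <;> simp [h]

theorem cornerDet_block_upper (a b : ℕ) (M : ℕ → ℕ → R)
    (h : ∀ i < b, ∀ j < a, M (a + i) j = 0) :
    cornerDet (a + b) M = cornerDet a M * cornerDet b (fun i j => M (a + i) (a + j)) := by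
  rw [← cornerDet_transpose, cornerDet_block_lower _ _ _ (fun i hi j hj => h j hj i hi),
    cornerDet_transpose, cornerDet_transpose b fun i j => M (a + i) (a + j)]

theorem cornerDet_mul_row (N : ℕ) (v : ℕ → R) (M : ℕ → ℕ → R) :
    cornerDet N (fun i j => v i * M i j) = (∏ i ∈ range N, v i) * cornerDet N M := by
  unfold cornerDet
  rw [Finset.prod_range, ← Matrix.det_mul_column]
  rfl

theorem cornerDet_mul_col (N : ℕ) (v : ℕ → R) (M : ℕ → ℕ → R) :
    cornerDet N (fun i j => v j * M i j) = (∏ i ∈ range N, v i) * cornerDet N M := by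
  rw [← cornerDet_transpose, cornerDet_mul_row, cornerDet_transpose N M]

theorem cornerDet_linear_col {N : ℕ} (c : ℕ) (hc : c < N) (s t : R) {M M₁ M₂ : ℕ → ℕ → R}
    (h₁ : ∀ i < N, ∀ j < N, j ≠ c → M i j = M₁ i j)
    (h₂ : ∀ i < N, ∀ j < N, j ≠ c → M i j = M₂ i j)
    (h : ∀ i < N, M i c = s * M₁ i c + t * M₂ i c) :
    cornerDet N M = s * cornerDet N M₁ + t * cornerDet N M₂ := by
  unfold cornerDet
  set P : Matrix (Fin N) (Fin N) R := Matrix.of fun i j : Fin N => M i j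
  have e : P = P.updateCol ⟨c, hc⟩ ((s • fun i : Fin N => M₁ i c) + t • fun i : Fin N => M₂ i c) := by
    ext i j
    by_cases hj : j = ⟨c, hc⟩
    · subst hj; simp [P, h]
    · simp [P, hj]
  have e₁ : (Matrix.of fun i j : Fin N => M₁ i j) = P.updateCol ⟨c, hc⟩ (fun i : Fin N => M₁ i c) := by
    ext i j
    by_cases hj : j = ⟨c, hc⟩
    · subst hj; simp
    · have : (j : ℕ) ≠ c := fun h => hj (Fin.ext h)
      simp [P, hj, h₁ i i.2 j j.2 this]
  have e₂ : (Matrix.of fun i j : Fin N => M₂ i j) = P.updateCol ⟨c, hc⟩ (fun i : Fin N => M₂ i c) := by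
    ext i j
    by_cases hj : j = ⟨c, hc⟩
    · subst hj; simp
    · have : (j : ℕ) ≠ c := fun h => hj (Fin.ext h)
      simp [P, hj, h₂ i i.2 j j.2 this]
  rw [e₁, e₂, e, Matrix.det_updateCol_add, Matrix.det_updateCol_smul, Matrix.det_updateCol_smul]
  simp

theorem cornerDet_swap {N o : ℕ} (ho : o + 1 < N) (M : ℕ → ℕ → R) :
    cornerDet N (fun i j => M (if i = o then o + 1 else if i = o + 1 then o else i) j) =
      - cornerDet N M := by
  unfold cornerDet
  have h := Matrix.det_permute (Equiv.swap (⟨o, by omega⟩ : Fin N) ⟨o + 1, ho⟩)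
    (Matrix.of fun i j : Fin N => M i j)
  rw [Equiv.Perm.sign_swap (by simp)] at h
  simp only [Units.val_neg, Units.val_one, Int.cast_neg, Int.cast_one, neg_mul, one_mul] at h
  rw [← h]
  congr 1
  ext i j
  simp only [Matrix.of_apply, Matrix.submatrix_apply, Equiv.swap_apply_def, id]
  congr 1
  simp only [Fin.ext_iff]
  split_ifs <;> rfl

/-- The map exchanging the adjacent blocks `[o, o + a)` and `[o + a, o + a + b)`. -/
def blockRot (o a b i : ℕ) : ℕ :=
  if i < o then i else if i < o + a then i + b else if i < o + a + b then i - a else i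

/-- The map reversing the block `[o, o + a)`. -/
def blockRev (o a i : ℕ) : ℕ :=
  if i < o then i else if i < o + a then 2 * o + a - 1 - i else i

theorem cornerDet_blockRot_one {N o b : ℕ} (h : o + 1 + b ≤ N) (M : ℕ → ℕ → R) :
    cornerDet N (fun i j => M (blockRot o 1 b i) j) = (-1) ^ b * cornerDet N M := by
  induction b generalizing M with
  | zero =>
    rw [pow_zero, one_mul]
    refine cornerDet_congr fun i _ j _ => ?_
    congr 1
    unfold blockRot
    split_ifs <;> omega
  | succ b ih =>
    have := ih (by omega) (fun i j => M (if i = o + b then o + b + 1 else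
      if i = o + b + 1 then o + b else i) j)
    rw [cornerDet_swap (by omega)] at this
    rw [pow_succ, mul_assoc, neg_one_mul, ← this]
    refine cornerDet_congr fun i _ j _ => ?_
    congr 1
    unfold blockRot
    split_ifs <;> omega

theorem cornerDet_blockRot {N o a b : ℕ} (h : o + a + b ≤ N) (M : ℕ → ℕ → R) :
    cornerDet N (fun i j => M (blockRot o a b i) j) = (-1) ^ (a * b) * cornerDet N M := by
  induction a with
  | zero =>
    rw [zero_mul, pow_zero, one_mul]
    refine cornerDet_congr fun i _ j _ => ?_
    congr 1
    unfold blockRot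
    split_ifs <;> omega
  | succ a ih =>
    have := cornerDet_blockRot_one (o := o + a) (b := b) (N := N) (by omega)
      (fun i j => M (blockRot o a b i) j)
    rw [ih (by omega)] at this
    rw [show (a + 1) * b = b + a * b by ring, pow_add, mul_assoc, ← this]
    refine cornerDet_congr fun i _ j _ => ?_
    congr 1
    unfold blockRot
    split_ifs <;> omega

theorem cornerDet_blockRev {N o a : ℕ} (h : o + a ≤ N) (M : ℕ → ℕ → R) :
    cornerDet N (fun i j => M (blockRev o a i) j) = (-1) ^ (a.choose 2) * cornerDet N M := by
  induction a with
  | zero =>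
    rw [Nat.choose_zero_succ, pow_zero, one_mul]
    refine cornerDet_congr fun i _ j _ => ?_
    congr 1
    unfold blockRev
    split_ifs <;> omega
  | succ a ih =>
    have := cornerDet_blockRot_one (o := o) (b := a) (N := N) (by omega)
      (fun i j => M (blockRev o a i) j)
    rw [ih (by omega)] at this
    rw [Nat.choose_succ_succ' a 1, Nat.choose_one_right, pow_add, mul_assoc, ← this]
    refine cornerDet_congr fun i _ j _ => ?_
    congr 1
    unfold blockRot blockRev
    split_ifs <;> omega

theorem cornerDet_blockRot_col {N o a b : ℕ} (h : o + a + b ≤ N) (M : ℕ → ℕ → R) :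
    cornerDet N (fun i j => M i (blockRot o a b j)) = (-1) ^ (a * b) * cornerDet N M := by
  rw [← cornerDet_transpose, cornerDet_blockRot h (fun i j => M j i), cornerDet_transpose]

theorem cornerDet_blockRev_col {N o a : ℕ} (h : o + a ≤ N) (M : ℕ → ℕ → R) :
    cornerDet N (fun i j => M i (blockRev o a j)) = (-1) ^ (a.choose 2) * cornerDet N M := by
  rw [← cornerDet_transpose, cornerDet_blockRev h (fun i j => M j i), cornerDet_transpose]

theorem sum_shifted_coeff_mul {N s : ℕ} {g : R[X]} (h : s + g.natDegree < N) (φ : ℕ → R) :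
    ∑ l ∈ range N, (if s ≤ l then g.coeff (l - s) else 0) * φ l =
      ∑ e ∈ range (g.natDegree + 1), g.coeff e * φ (s + e) := by
  obtain ⟨r, rfl⟩ : ∃ r, N = s + (g.natDegree + 1 + r) := ⟨N - s - g.natDegree - 1, by omega⟩
  rw [Finset.sum_range_add, Finset.sum_eq_zero, zero_add, Finset.sum_range_add]
  · rw [add_eq_left.2]
    · simp
    · refine Finset.sum_eq_zero fun i _ => ?_
      rw [if_pos (by omega), coeff_eq_zero_of_natDegree_lt (by omega), zero_mul]
  · intro i hi
    rw [if_neg (by simpa using hi), zero_mul]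

theorem sum_shifted_coeff_mul_pow {N s j : ℕ} {g : R[X]} (h : s + g.natDegree < N)
    {φ : ℕ → R} {y : R} (hφ : ∀ e ≤ g.natDegree, φ (s + e) = y ^ (j + e)) :
    ∑ l ∈ range N, (if s ≤ l then g.coeff (l - s) else 0) * φ l = y ^ j * g.eval y := by
  rw [sum_shifted_coeff_mul h, eval_eq_sum_range, Finset.mul_sum]
  refine Finset.sum_congr rfl fun e he => ?_
  rw [hφ e (by simp at he; omega), pow_add]
  ring

end CornerDet

section Sylvester

variable {R : Type*} [CommRing R]

/-- The coefficient of `t ^ c` in `t ^ j * f`. -/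
def shiftCoeff (f : R[X]) (j c : ℕ) : R :=
  if j ≤ c then f.coeff (c - j) else 0

/-- The array of coefficients of `t ^ (k + 1)`, …, `t ^ (k + p + q - 1)` in
`f, t f, …, t ^ (p - 1) f, g, t g, …, t ^ (q - 1) g`, bordered by `w` along the rows of `g`. -/
def sylvesterAsc (k p q : ℕ) (f g : R[X]) (w : ℕ → R) (i c : ℕ) : R :=
  if i < p then
    if c < p + q - 1 then shiftCoeff f i (k + 1 + c) else 0
  else
    if c < p + q - 1 then shiftCoeff g (i - p) (k + 1 + c) else w (i - p)

/-- The version of `sylvesterAsc` with decreasing degrees of rows and columns. -/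
def sylvesterDesc (k p q : ℕ) (f g : R[X]) (w : ℕ → R) (i c : ℕ) : R :=
  if i < p then
    if c = p + q - 1 then 0
    else if c ≤ k + q + i then f.coeff (k + q + i - c) else 0
  else
    if c = p + q - 1 then w (q - 1 - (i - p))
    else if c ≤ k + p + (i - p) then g.coeff (k + p + (i - p) - c) else 0

theorem choose_two_add (a b : ℕ) :
    (a + b).choose 2 = a.choose 2 + b.choose 2 + a * b := by
  induction b with
  | zero => simp
  | succ b ih =>
    rw [← add_assoc, Nat.choose_succ_succ' (a + b) 1, ih, Nat.choose_succ_succ' b 1,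
      Nat.choose_one_right, Nat.choose_one_right]
    ring

theorem cornerDet_sylvesterDesc (k p q : ℕ) (f g : R[X]) (w : ℕ → R) :
    cornerDet (p + 1 + (q + 1)) (sylvesterDesc k (p + 1) (q + 1) f g w) =
      (-1) ^ (p * q) * cornerDet (p + 1 + (q + 1)) (sylvesterAsc k (p + 1) (q + 1) f g w) := by
  have h₁ := cornerDet_blockRev (N := p + 1 + (q + 1)) (o := 0) (a := p + 1) (by omega)
    (sylvesterAsc k (p + 1) (q + 1) f g w)
  have h₂ := cornerDet_blockRev (N := p + 1 + (q + 1)) (o := p + 1) (a := q + 1) (by omega)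
    (fun i => sylvesterAsc k (p + 1) (q + 1) f g w (blockRev 0 (p + 1) i))
  have h₃ := cornerDet_blockRev_col (N := p + 1 + (q + 1)) (o := 0) (a := p + 1 + q) (by omega)
    (fun i => sylvesterAsc k (p + 1) (q + 1) f g w
      (blockRev 0 (p + 1) (blockRev (p + 1) (q + 1) i)))
  rw [h₂, h₁] at h₃
  have e : (-1 : R) ^ (p * q) = (-1) ^ ((p + 1 + q).choose 2) *
      ((-1) ^ ((q + 1).choose 2) * (-1) ^ ((p + 1).choose 2)) := by
    rw [← pow_add, ← pow_add]
    apply neg_one_pow_congr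
    rw [choose_two_add (p + 1) q, Nat.choose_succ_succ' q 1, Nat.choose_one_right]
    simp only [parity_simps]
    tauto
  rw [e, mul_assoc, mul_assoc, ← h₃]
  refine cornerDet_congr fun i hi c hc => ?_
  by_cases hip : i < p + 1
  · have hi' : blockRev 0 (p + 1) (blockRev (p + 1) (q + 1) i) = p - i := by
      unfold blockRev; split_ifs <;> omega
    rw [hi']
    by_cases hcl : c = p + 1 + q
    · have hc' : blockRev 0 (p + 1 + q) c = p + 1 + q := by
        unfold blockRev; split_ifs <;> omega
      rw [hc']
      simp only [sylvesterDesc, sylvesterAsc]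
      repeat rw [if_pos (by omega)]
      rw [if_neg (by omega)]
    · have hc' : blockRev 0 (p + 1 + q) c = p + q - c := by
        unfold blockRev; split_ifs <;> omega
      rw [hc']
      simp only [sylvesterDesc, sylvesterAsc, shiftCoeff]
      rw [if_pos hip, if_neg (by omega), if_pos (by omega : p - i < p + 1), if_pos (by omega :
        p + q - c < p + 1 + (q + 1) - 1)]
      by_cases hcc : c ≤ k + (q + 1) + i
      · rw [if_pos hcc, if_pos (by omega)]
        congr 1
        omega
      · rw [if_neg hcc, if_neg (by omega)]
  · have hi' : blockRev 0 (p + 1) (blockRev (p + 1) (q + 1) i) = p + 1 + (q - (i - (p + 1))) := by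
      unfold blockRev; split_ifs <;> omega
    rw [hi']
    by_cases hcl : c = p + 1 + q
    · have hc' : blockRev 0 (p + 1 + q) c = p + 1 + q := by
        unfold blockRev; split_ifs <;> omega
      rw [hc']
      simp only [sylvesterDesc, sylvesterAsc]
      rw [if_neg hip, if_pos (by omega), if_neg (by omega), if_neg (by omega)]
      congr 1
      omega
    · have hc' : blockRev 0 (p + 1 + q) c = p + q - c := by
        unfold blockRev; split_ifs <;> omega
      rw [hc']
      simp only [sylvesterDesc, sylvesterAsc, shiftCoeff]
      rw [if_neg hip, if_neg (by omega), if_neg (by omega :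
        ¬ p + 1 + (q - (i - (p + 1))) < p + 1), if_pos (by omega :
        p + q - c < p + 1 + (q + 1) - 1), Nat.add_sub_cancel_left]
      by_cases hcc : c ≤ k + (p + 1) + (i - (p + 1))
      · rw [if_pos hcc, if_pos (by omega)]
        congr 1
        omega
      · rw [if_neg hcc, if_neg (by omega)]

/-- `sylvesterDesc` with the bordering column along the rows of `f`. -/
theorem cornerDet_sylvesterDesc_swap (k p q : ℕ) (f g : R[X]) (w : ℕ → R) :
    cornerDet (p + q) (fun i c =>
      if i < p then
        if c = p + q - 1 then w (p - 1 - i)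
        else if c ≤ k + q + i then f.coeff (k + q + i - c) else 0
      else
        if c = p + q - 1 then 0
        else if c ≤ k + p + (i - p) then g.coeff (k + p + (i - p) - c) else 0) =
      (-1) ^ (p * q) * cornerDet (q + p) (sylvesterDesc k q p g f w) := by
  rw [add_comm q p, ← cornerDet_blockRot (o := 0) (by omega)]
  refine cornerDet_congr fun i hi c hc => ?_
  by_cases hip : i < p
  · have hi' : blockRot 0 p q i = q + i := by unfold blockRot; split_ifs <;> omega
    rw [hi']
    simp [sylvesterDesc, hip, add_comm q p]
  · have hi' : blockRot 0 p q i = i - p := by unfold blockRot; split_ifs <;> omega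
    have : i - p < q := by omega
    rw [hi']
    simp [sylvesterDesc, hip, add_comm q p, this]

theorem cornerDet_eval_remainders (k p q : ℕ) (f g : R[X]) (w a : ℕ → R)
    (hf : f.natDegree = k + q + 1) (hfm : f.Monic) (hg : g.natDegree = k + p + 1)
    (ha : ∀ c < k + q + 1, f.eval (a c) = 0) :
    cornerDet (k + q + 2) (fun i c =>
      if i < k + 1 then
        if c < k + q + 1 then a c ^ i else 0
      else
        if c < k + q + 1 then a c ^ (i - (k + 1)) * g.eval (a c) else w (i - (k + 1))) =
      (-1) ^ ((p + 1) * q) * (cornerDet (k + q + 1) (fun i c => a c ^ i) *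
        cornerDet (p + 1 + (q + 1)) (sylvesterAsc k (p + 1) (q + 1) f g w)) := by
  set L : ℕ → ℕ → R := fun i c =>
    if i < k + 1 then if c = i then 1 else 0
    else if i < k + 1 + (p + 1) then
      if c < k + p + q + 2 then shiftCoeff f (i - (k + 1)) c else 0
    else
      if c < k + p + q + 2 then shiftCoeff g (i - (k + p + 2)) c else w (i - (k + p + 2)) with hL
  set W : ℕ → ℕ → R := fun e c =>
    if c < k + q + 1 then if e < k + p + q + 2 then a c ^ e else 0
    else if e = c then 1 else 0 with hW
  set P : ℕ → ℕ → R := fun i c =>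
    if c < k + q + 1 then
      if i < k + 1 then a c ^ i
      else if i < k + 1 + (p + 1) then 0
      else a c ^ (i - (k + p + 2)) * g.eval (a c)
    else L i c with hP
  have hLdet : cornerDet (k + p + q + 3) L =
      cornerDet (p + 1 + (q + 1)) (sylvesterAsc k (p + 1) (q + 1) f g w) := by
    rw [show k + p + q + 3 = k + 1 + (p + 1 + (q + 1)) by ring, cornerDet_block_lower,
      cornerDet_lower, one_mul]
    · refine cornerDet_congr fun i hi c hc => ?_
      simp only [hL, sylvesterAsc]
      rw [if_neg (by omega)]
      split_ifs <;> first | omega | rfl | (congr 1; omega)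
    · intro i hi j hj hij
      simp only [hL]
      rw [if_pos (by omega), if_neg (by omega)]
    · intro i hi
      simp only [hL, if_pos hi, if_true]
    · intro i hi j hj
      simp only [hL]
      rw [if_pos (by omega), if_neg (by omega)]
  have hWdet : cornerDet (k + p + q + 3) W = cornerDet (k + q + 1) (fun i c => a c ^ i) := by
    rw [show k + p + q + 3 = k + q + 1 + (p + 2) by ring, cornerDet_block_lower,
      cornerDet_lower (N := p + 2), mul_one]
    · refine cornerDet_congr fun i hi c hc => ?_
      simp only [hW]
      rw [if_pos (by omega), if_pos (by omega)]
    · intro i hi j hj hij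
      simp only [hW]
      rw [if_neg (by omega), if_neg (by omega)]
    · intro i hi
      simp only [hW]
      rw [if_neg (by omega), if_true]
    · intro i hi j hj
      simp only [hW]
      rw [if_neg (by omega), if_neg (by omega)]
  have hmul : cornerDet (k + p + q + 3) L * cornerDet (k + p + q + 3) W =
      cornerDet (k + p + q + 3) P := by
    rw [cornerDet_mul]
    refine cornerDet_congr fun i hi c hc => ?_
    by_cases hcm : c < k + q + 1
    · have key : ∀ l ∈ range (k + p + q + 2), L i l * W l c = L i l * a c ^ l := by
        intro l hl
        rw [Finset.mem_range] at hl
        simp only [hW, if_pos hcm, if_pos hl]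
      have hlast : W (k + p + q + 2) c = 0 := by simp only [hW, if_pos hcm, lt_irrefl, if_false]
      rw [Finset.sum_range_succ, hlast, mul_zero, add_zero, Finset.sum_congr rfl key]
      simp only [hP, if_pos hcm]
      by_cases h1 : i < k + 1
      · simp only [hL, if_pos h1]
        simp
        omega
      · by_cases h2 : i < k + 1 + (p + 1)
        · rw [if_neg h1, if_pos h2]
          trans a c ^ (i - (k + 1)) * f.eval (a c)
          · rw [← sum_shifted_coeff_mul_pow (N := k + p + q + 2) (s := i - (k + 1))
              (φ := fun l => a c ^ l) (by omega) (fun _ _ => rfl)]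
            refine Finset.sum_congr rfl fun l hl => ?_
            rw [Finset.mem_range] at hl
            simp only [hL, h1, h2, hl, shiftCoeff, if_true, if_false]
          · rw [ha c hcm, mul_zero]
        · rw [if_neg h1, if_neg h2]
          rw [← sum_shifted_coeff_mul_pow (N := k + p + q + 2) (s := i - (k + p + 2))
              (φ := fun l => a c ^ l) (by omega) (fun _ _ => rfl)]
          refine Finset.sum_congr rfl fun l hl => ?_
          rw [Finset.mem_range] at hl
          simp only [hL, h1, h2, hl, shiftCoeff, if_true, if_false]
    · simp only [hP, hW, if_neg hcm]
      simp [hc]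
  have hrow := cornerDet_blockRot (N := k + p + q + 3) (o := k + 1) (a := q + 1) (b := p + 1)
    (by omega) P
  have hcol := cornerDet_blockRot_col (N := k + p + q + 3) (o := k + q + 1) (a := 1) (b := p + 1)
    (by omega) (fun i c => P (blockRot (k + 1) (q + 1) (p + 1) i) c)
  rw [hrow, ← hmul, hLdet, hWdet] at hcol
  have hN : k + p + q + 3 = k + q + 2 + (p + 1) := by ring
  rw [hN, cornerDet_block_upper, cornerDet_lower (N := p + 1), mul_one] at hcol
  · trans (-1) ^ (1 * (p + 1)) * ((-1) ^ ((q + 1) * (p + 1)) *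
      (cornerDet (p + 1 + (q + 1)) (sylvesterAsc k (p + 1) (q + 1) f g w) *
        cornerDet (k + q + 1) fun i c => a c ^ i))
    · rw [← hcol]
      refine cornerDet_congr fun i hi c hc => ?_
      have hi' : blockRot (k + 1) (q + 1) (p + 1) i = if i < k + 1 then i else i + (p + 1) := by
        unfold blockRot; split_ifs <;> omega
      have hc' : blockRot (k + q + 1) 1 (p + 1) c =
          if c < k + q + 1 then c else k + p + q + 2 := by
        unfold blockRot; split_ifs <;> omega
      rw [hi', hc']
      by_cases h1 : i < k + 1 <;> by_cases h2 : c < k + q + 1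
      · simp only [h1, h2, hP, if_true]
      · have e1 : k + p + q + 2 ≠ i := by omega
        have e2 : ¬ k + p + q + 2 < k + q + 1 := by omega
        simp only [h1, h2, hP, hL, e1, e2, if_true, if_false]
      · have e1 : ¬ i + (p + 1) < k + 1 := by omega
        have e2 : ¬ i + (p + 1) < k + 1 + (p + 1) := by omega
        have e3 : i + (p + 1) - (k + p + 2) = i - (k + 1) := by omega
        simp only [h1, h2, hP, e1, e2, e3, if_true, if_false]
      · have e1 : ¬ i + (p + 1) < k + 1 := by omega
        have e2 : ¬ i + (p + 1) < k + 1 + (p + 1) := by omega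
        have e3 : i + (p + 1) - (k + p + 2) = i - (k + 1) := by omega
        have e4 : ¬ k + p + q + 2 < k + q + 1 := by omega
        simp only [h1, h2, hP, hL, e1, e2, e3, e4, if_false, lt_irrefl]
    · rw [← mul_assoc, ← pow_add, mul_comm (cornerDet _ _) (cornerDet _ _)]
      congr 1
      apply neg_one_pow_congr
      simp only [parity_simps]
      tauto
  · intro i hi j hj hij
    have hi' : blockRot (k + 1) (q + 1) (p + 1) (k + q + 2 + i) = k + 1 + i := by
      unfold blockRot; split_ifs <;> omega
    have hj' : blockRot (k + q + 1) 1 (p + 1) (k + q + 2 + j) = k + q + 1 + j := by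
      unfold blockRot; split_ifs <;> omega
    rw [hi', hj']
    simp only [hP, hL, shiftCoeff]
    rw [if_neg (by omega), if_neg (by omega), if_pos (by omega), if_pos (by omega),
      if_pos (by omega), coeff_eq_zero_of_natDegree_lt (by omega)]
  · intro i hi
    have hi' : blockRot (k + 1) (q + 1) (p + 1) (k + q + 2 + i) = k + 1 + i := by
      unfold blockRot; split_ifs <;> omega
    have hj' : blockRot (k + q + 1) 1 (p + 1) (k + q + 2 + i) = k + q + 1 + i := by
      unfold blockRot; split_ifs <;> omega
    rw [hi', hj']
    simp only [hP, hL, shiftCoeff]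
    rw [if_neg (by omega), if_neg (by omega), if_pos (by omega), if_pos (by omega),
      if_pos (by omega), show k + q + 1 + i - (k + 1 + i - (k + 1)) = f.natDegree by omega]
    exact hfm.leadingCoeff
  · intro i hi j hj
    have hi' : blockRot (k + 1) (q + 1) (p + 1) (k + q + 2 + i) = k + 1 + i := by
      unfold blockRot; split_ifs <;> omega
    rw [hi']
    by_cases hjm : j < k + q + 1
    · have hj' : blockRot (k + q + 1) 1 (p + 1) j = j := by
        unfold blockRot; split_ifs; omega
      rw [hj']
      simp only [hP]
      rw [if_pos hjm, if_neg (by omega), if_pos (by omega)]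
    · have hj' : blockRot (k + q + 1) 1 (p + 1) j = k + p + q + 2 := by
        unfold blockRot; split_ifs; omega
      rw [hj']
      simp only [hP, hL]
      rw [if_neg (by omega), if_neg (by omega), if_pos (by omega), if_neg (by omega)]

/-- The array with rows `(0 | a ^ i | 0)` for `i ≤ k`, followed by rows `(b ^ j | a ^ j | x ^ j)`. -/
def vandermondePair (k n m : ℕ) (a b : ℕ → R) (x : R) (i c : ℕ) : R :=
  if i < k + 1 then
    if c < n then 0 else if c < n + m then a (c - n) ^ i else 0
  else
    if c < n then b c ^ (i - (k + 1))
    else if c < n + m then a (c - n) ^ (i - (k + 1)) else x ^ (i - (k + 1))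

theorem cornerDet_vandermondePair (k p q : ℕ) (f g : R[X]) (a b : ℕ → R) (x : R)
    (hf : f.natDegree = k + q + 1) (hfm : f.Monic) (hg : g.natDegree = k + p + 1) (hgm : g.Monic)
    (ha : ∀ c < k + q + 1, f.eval (a c) = 0) (hb : ∀ c < k + p + 1, g.eval (b c) = 0) :
    cornerDet (k + p + 1 + (k + q + 1) + 1) (vandermondePair k (k + p + 1) (k + q + 1) a b x) =
      (-1) ^ ((k + 1) * (k + p + 1) + q) *
        (cornerDet (k + q + 1) (fun i c => a c ^ i) * cornerDet (k + p + 1) (fun i c => b c ^ i)) *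
        (cornerDet (p + 1 + (q + 1)) (sylvesterDesc k (p + 1) (q + 1) f g (fun j => x ^ j)) *
          g.eval x) := by
  set n := k + p + 1 with hn
  set m := k + q + 1 with hm
  set M := vandermondePair k n m a b x with hM
  set L : ℕ → ℕ → R := fun i l =>
    if i < k + 1 + n then if l = i then 1 else 0 else shiftCoeff g (i - n) l with hL
  have hLdet : cornerDet (n + m + 1) L = 1 := by
    apply cornerDet_lower
    · intro i hi j hj hij
      simp only [hL, shiftCoeff]
      split_ifs with h1 h2 h3
      · omega
      · rfl
      · exact coeff_eq_zero_of_natDegree_lt (by omega)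
      · rfl
    · intro i hi
      simp only [hL, shiftCoeff]
      split_ifs with h1 h2
      · rfl
      · rw [show i - (i - n) = g.natDegree by omega]
        exact hgm.leadingCoeff
      · omega
  set P : ℕ → ℕ → R := fun i c =>
    if i < k + 1 + n then M i c
    else if c < n then 0
    else if c < n + m then a (c - n) ^ (i - n - (k + 1)) * g.eval (a (c - n))
    else x ^ (i - n - (k + 1)) * g.eval x with hP
  have hPdet : cornerDet (n + m + 1) M = cornerDet (n + m + 1) P := by
    rw [← one_mul (cornerDet _ M), ← hLdet, cornerDet_mul]
    refine cornerDet_congr fun i hi c hc => ?_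
    simp only [hP, hL]
    by_cases h1 : i < k + 1 + n
    · simp [h1, hi]
    · simp only [if_neg h1, shiftCoeff]
      by_cases h2 : c < n
      · rw [if_pos h2, sum_shifted_coeff_mul_pow (y := b c) (j := i - n - (k + 1)) (by omega),
          hb c h2, mul_zero]
        intro e he
        simp only [hM, vandermondePair]
        rw [if_neg (by omega), if_pos h2]
        congr 1
        omega
      · by_cases h3 : c < n + m
        · rw [if_neg h2, if_pos h3, sum_shifted_coeff_mul_pow (by omega)]
          intro e he
          simp only [hM, vandermondePair]
          rw [if_neg (by omega), if_neg h2, if_pos h3]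
          congr 1
          omega
        · rw [if_neg h2, if_neg h3, sum_shifted_coeff_mul_pow (by omega)]
          intro e he
          simp only [hM, vandermondePair]
          rw [if_neg (by omega), if_neg h2, if_neg h3]
          congr 1
          omega
  have hrow := cornerDet_blockRot (N := n + m + 1) (o := 0) (a := n) (b := k + 1) (by omega) P
  have hr₁ : ∀ i < n, blockRot 0 n (k + 1) i = k + 1 + i := by
    intro i hi
    unfold blockRot; split_ifs <;> omega
  have hr₂ : ∀ i < k + 1, blockRot 0 n (k + 1) (n + i) = i := by
    intro i hi
    unfold blockRot; split_ifs <;> omega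
  have hr₃ : ∀ i, ¬ i < k + 1 → blockRot 0 n (k + 1) (n + i) = n + i := by
    intro i hi
    unfold blockRot; split_ifs <;> omega
  rw [← hPdet, add_assoc, cornerDet_block_upper] at hrow
  · have hV : cornerDet n (fun i j => P (blockRot 0 n (k + 1) i) j) =
        cornerDet n (fun i c => b c ^ i) := by
      refine cornerDet_congr fun i hi c hc => ?_
      rw [hr₁ i hi]
      simp only [hP, hM, vandermondePair]
      rw [if_pos (by omega), if_neg (by omega), if_pos hc, Nat.add_sub_cancel_left]
    have hH : cornerDet (m + 1) (fun i j => P (blockRot 0 n (k + 1) (n + i)) (n + j)) =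
        g.eval x * ((-1) ^ ((p + 1) * q) * (cornerDet m (fun i c => a c ^ i) *
        cornerDet (p + 1 + (q + 1))
          (sylvesterAsc k (p + 1) (q + 1) f g (fun j => x ^ j)))) := by
      rw [← cornerDet_eval_remainders k p q f g _ a hf hfm hg ha]
      have hprod : ∏ i ∈ range (m + 1), (if i < m then 1 else g.eval x) = g.eval x := by
        rw [Finset.prod_range_succ, Finset.prod_eq_one, one_mul, if_neg (lt_irrefl _)]
        intro i hi
        rw [if_pos (Finset.mem_range.1 hi)]
      rw [show k + q + 2 = m + 1 by omega, ← hprod, ← cornerDet_mul_col]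
      refine cornerDet_congr fun i hi c hc => ?_
      by_cases h1 : i < k + 1
      · rw [hr₂ i h1]
        have e1 : i < k + 1 + n := by omega
        by_cases h2 : c < m
        · have h3 : c < k + q + 1 := h2
          simp [hP, hM, vandermondePair, h1, e1, h2, h3, -Order.lt_add_one_iff]
        · have h3 : ¬ c < k + q + 1 := h2
          simp [hP, hM, vandermondePair, h1, e1, h2, h3, -Order.lt_add_one_iff]
      · rw [hr₃ i h1]
        have e1 : ¬ n + i < k + 1 + n := by omega
        by_cases h2 : c < m
        · have h3 : c < k + q + 1 := h2
          simp [hP, h1, e1, h2, h3, -Order.lt_add_one_iff]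
        · have h3 : ¬ c < k + q + 1 := h2
          simp [hP, h1, e1, h2, h3, -Order.lt_add_one_iff, mul_comm]
    rw [hV, hH] at hrow
    rw [cornerDet_sylvesterDesc, add_assoc n m 1]
    have hs : ∀ s : ℕ, (-1 : R) ^ s * (-1) ^ s = 1 := fun s => by
      rw [← mul_pow, neg_one_mul, neg_neg, one_pow]
    have hMdet := congrArg (fun y => (-1) ^ (n * (k + 1)) * y) hrow
    simp only [← mul_assoc, hs, one_mul] at hMdet
    rw [← hMdet]
    have e : (-1 : R) ^ ((k + 1) * n + q) = (-1) ^ (n * (k + 1)) * (-1) ^ ((p + 1) * q) *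
        (-1) ^ (p * q) := by
      rw [← pow_add, ← pow_add]
      apply neg_one_pow_congr
      simp only [parity_simps]
      tauto
    rw [e]
    linear_combination (-(-1) ^ (n * (k + 1)) * (-1) ^ ((p + 1) * q) *
      cornerDet m (fun i c => a c ^ i) * cornerDet n (fun i c => b c ^ i) * g.eval x *
      cornerDet (p + 1 + (q + 1)) (sylvesterAsc k (p + 1) (q + 1) f g (fun j => x ^ j))) *
      hs (p * q)
  · intro i hi j hj
    by_cases h1 : i < k + 1
    · rw [hr₂ i h1]
      simp only [hP, hM, vandermondePair]
      rw [if_pos (by omega), if_pos h1, if_pos hj]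
    · rw [hr₃ i h1]
      simp only [hP]
      rw [if_neg (by omega), if_pos hj]

/-- The determinant with rows `(b ^ i | T a ^ i)` for `i ≤ k`, followed by rows
`(b ^ j (x - b) | a ^ j (x - a))`. -/
def doubleSumArray (k n : ℕ) (a b : ℕ → R) (x T : R) (i c : ℕ) : R :=
  if i < k + 1 then
    if c < n then b c ^ i else T * a (c - n) ^ i
  else
    if c < n then b c ^ (i - (k + 1)) * (x - b c)
    else a (c - n) ^ (i - (k + 1)) * (x - a (c - n))

/-- The array `doubleSumArray` bordered by a column of powers of `x`. -/
def borderedArray (k n m : ℕ) (a b : ℕ → R) (x T : R) (i c : ℕ) : R :=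
  if i < k + 1 then
    if c < n then b c ^ i else if c < n + m then T * a (c - n) ^ i else 0
  else
    if c < n then b c ^ (i - (k + 1))
    else if c < n + m then a (c - n) ^ (i - (k + 1)) else x ^ (i - (k + 1))

theorem prod_range_ite_lt (s t : ℕ) (u v : R) :
    ∏ i ∈ range (s + t), (if i < s then u else v) = u ^ s * v ^ t := by
  rw [Finset.prod_range_add]
  congr 1
  · rw [Finset.prod_congr rfl fun i hi => if_pos (Finset.mem_range.1 hi)]
    simp
  · simp

theorem cornerDet_borderedArray {k n m d : ℕ} (h : n + m = k + 1 + d) (a b : ℕ → R) (x T : R) :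
    cornerDet (n + m + 1) (borderedArray k n m a b x T) =
      cornerDet (n + m) (doubleSumArray k n a b x T) := by
  set M := borderedArray k n m a b x T with hM
  set L : ℕ → ℕ → R := fun i l =>
    if l = i then 1 else if k + 1 < i ∧ l = i - 1 then -x else 0 with hL
  have hLdet : cornerDet (n + m + 1) L = 1 := by
    apply cornerDet_lower
    · intro i hi j hj hij
      simp only [hL]
      rw [if_neg (by omega), if_neg (by omega)]
    · intro i hi
      simp [hL]
  set P : ℕ → ℕ → R := fun i c =>
    if i < k + 2 then M i c else M i c - x * M (i - 1) c with hP
  have hPdet : cornerDet (n + m + 1) M = cornerDet (n + m + 1) P := by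
    rw [← one_mul (cornerDet _ M), ← hLdet, cornerDet_mul]
    refine cornerDet_congr fun i hi c hc => ?_
    have e : ∀ l ∈ range (n + m + 1), L i l * M l c = (if l = i then M i c else 0) +
        if l = i - 1 then if k + 1 < i then -x * M (i - 1) c else 0 else 0 := by
      intro l _
      simp only [hL]
      split_ifs <;> first | omega | simp_all
    rw [Finset.sum_congr rfl e, Finset.sum_add_distrib, Finset.sum_ite_eq', Finset.sum_ite_eq',
      if_pos (by simpa using hi), if_pos (by simp; omega)]
    simp only [hP]
    split_ifs
    · omega
    · ring
    · ring
    · omega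
  have hrow := cornerDet_blockRot (N := n + m + 1) (o := k + 1) (a := d) (b := 1) (by omega) P
  have hr₁ : ∀ i < k + 1, blockRot (k + 1) d 1 i = i := by
    intro i hi
    unfold blockRot; split_ifs; omega
  have hr₂ : ∀ i < n + m, ¬ i < k + 1 → blockRot (k + 1) d 1 i = i + 1 := by
    intro i hi
    unfold blockRot; split_ifs <;> omega
  have hr₃ : blockRot (k + 1) d 1 (n + m) = k + 1 := by
    unfold blockRot; split_ifs <;> omega
  rw [← hPdet, cornerDet_block_lower, cornerDet_lower (N := 1), mul_one, mul_one] at hrow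
  · have hs : (-1 : R) ^ d * (-1) ^ d = 1 := by
      rw [← mul_pow, neg_one_mul, neg_neg, one_pow]
    rw [← one_mul (cornerDet (n + m + 1) M), ← hs, mul_assoc, ← hrow]
    have hprod : ∏ i ∈ range (n + m), (if i < k + 1 then (1 : R) else -1) = (-1) ^ d := by
      rw [h, prod_range_ite_lt, one_pow, one_mul]
    rw [← hprod, ← cornerDet_mul_row]
    refine cornerDet_congr fun i hi c hc => ?_
    by_cases h1 : i < k + 1
    · rw [hr₁ i h1]
      simp only [hP, hM, borderedArray, doubleSumArray]
      simp only [if_pos h1, if_pos (show i < k + 2 by omega), one_mul, if_pos hc]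
    · rw [hr₂ i hi h1]
      simp only [hP, hM, borderedArray, doubleSumArray, Nat.add_sub_cancel]
      have e : i + 1 - (k + 1) = i - (k + 1) + 1 := by omega
      rw [if_neg h1, if_neg (by omega), if_neg (by omega), if_neg h1, if_neg h1, if_pos hc,
        if_pos hc, e]
      split_ifs <;> ring
  · intro i hi j hj hij
    omega
  · intro i hi
    obtain rfl : i = 0 := by omega
    rw [add_zero, hr₃]
    simp [hP, hM, borderedArray]
  · intro i hi j hj
    obtain rfl : j = 0 := by omega
    rw [add_zero]
    by_cases h1 : i < k + 1
    · rw [hr₁ i h1]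
      simp only [hP, hM, borderedArray]
      rw [if_pos (by omega), if_pos h1, if_neg (by omega), if_neg (by omega)]
    · rw [hr₂ i hi h1]
      simp only [hP, hM, borderedArray, Nat.add_sub_cancel]
      have e : i + 1 - (k + 1) = i - (k + 1) + 1 := by omega
      rw [if_neg (by omega), if_neg (by omega), if_neg (by omega), if_neg (by omega), if_neg h1,
        if_neg (by omega), if_neg (by omega), e]
      ring

/-- Subtracting from each of the first `s` rows of an array the row `s` places below. -/
theorem cornerDet_sub_row {N s : ℕ} (hs : 2 * s ≤ N) (M : ℕ → ℕ → R) :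
    cornerDet N (fun i c => if i < s then M i c - M (i + s) c else M i c) = cornerDet N M := by
  set L : ℕ → ℕ → R := fun i l =>
    if l = i then 1 else if i < s ∧ l = i + s then -1 else 0 with hL
  have hLdet : cornerDet N L = 1 := by
    apply cornerDet_upper
    · intro i hi j hj hij
      simp only [hL]
      rw [if_neg (by omega), if_neg (by omega)]
    · intro i hi
      simp [hL]
  rw [← one_mul (cornerDet _ M), ← hLdet, cornerDet_mul]
  refine cornerDet_congr fun i hi c hc => ?_
  have e : ∀ l ∈ range N, L i l * M l c = (if l = i then M i c else 0) +
      if l = i + s then if i < s then - M (i + s) c else 0 else 0 := by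
    intro l _
    simp only [hL]
    split_ifs <;> first | omega | simp_all
  rw [Finset.sum_congr rfl e, Finset.sum_add_distrib, Finset.sum_ite_eq', Finset.sum_ite_eq',
    if_pos (Finset.mem_range.2 hi)]
  by_cases h1 : i < s
  · rw [if_pos h1, if_pos (Finset.mem_range.2 (by omega)), if_pos h1, sub_eq_add_neg]
  · simp [h1]

theorem cornerDet_doubleSumArray_mul {k n m d : ℕ} (h : n + m = k + 1 + d) (hkd : k ≤ d)
    (a b : ℕ → R) (x T : R) :
    (T - 1) * cornerDet (n + m) (doubleSumArray k n a b x T) =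
      (T - 1) ^ (k + 1) * (T * cornerDet (n + m + 1) (vandermondePair k n m a b x) -
        (-1) ^ (k + 1 + m * n) * cornerDet (m + n + 1) (vandermondePair k m n b a x)) := by
  set D : ℕ → ℕ → R := fun i c =>
    if i < k + 1 then
      if c < n then 0 else if c < n + m then a (c - n) ^ i else x ^ i
    else
      if c < n then b c ^ (i - (k + 1))
      else if c < n + m then a (c - n) ^ (i - (k + 1)) else x ^ (i - (k + 1)) with hD
  set E : ℕ → ℕ → R := fun i c =>
    if i < k + 1 then
      if c < n then 0 else if c < n + m then a (c - n) ^ i else - x ^ i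
    else
      if c < n then b c ^ (i - (k + 1))
      else if c < n + m then a (c - n) ^ (i - (k + 1)) else (T - 1) * x ^ (i - (k + 1)) with hE
  have hDdet : cornerDet (n + m + 1) D =
      (-1) ^ (k + 1 + m * n) * cornerDet (m + n + 1) (vandermondePair k m n b a x) := by
    have hcol := cornerDet_blockRot_col (N := m + n + 1) (o := 0) (a := n) (b := m) (by omega)
      (vandermondePair k m n b a x)
    have hprod : ∏ i ∈ range (m + n + 1), (if i < k + 1 then (-1 : R) else 1) =
        (-1) ^ (k + 1) := by
      rw [show m + n + 1 = k + 1 + (d + 1) by omega, prod_range_ite_lt, one_pow, mul_one]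
    rw [mul_comm m n, pow_add, mul_assoc, ← hcol, ← hprod, ← cornerDet_mul_row,
      ← cornerDet_sub_row (s := k + 1) (by omega), add_comm m n]
    refine cornerDet_congr fun i hi c hc => ?_
    have hc' : blockRot 0 n m c = if c < n then c + m else if c < n + m then c - n else c := by
      unfold blockRot; split_ifs <;> omega
    have e1 : ¬ i + (k + 1) < k + 1 := by omega
    rw [hc']
    simp only [hD, vandermondePair, e1, if_false, Nat.add_sub_cancel]
    by_cases h1 : i < k + 1
    · simp only [if_pos h1]
      split_ifs <;> first | omega | simp
    · simp only [if_neg h1]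
      split_ifs <;> first | omega | simp
  have hEdet : cornerDet (n + m + 1) E = T * cornerDet (n + m + 1) (vandermondePair k n m a b x) +
      (-1) * cornerDet (n + m + 1) D := by
    apply cornerDet_linear_col (n + m) (by omega)
    · intro i hi j hj hjc
      have : j < n + m := by omega
      simp only [hE, vandermondePair, if_pos this]
    · intro i hi j hj hjc
      have : j < n + m := by omega
      simp only [hE, hD, if_pos this]
    · intro i hi
      simp only [hE, hD, vandermondePair]
      have : ¬ n + m < n := by omega
      simp only [this, lt_irrefl, if_false]
      split_ifs <;> ring
  rw [← hDdet, sub_eq_add_neg (T * _), ← neg_one_mul (cornerDet _ D), ← hEdet]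
  rw [← cornerDet_borderedArray h, ← cornerDet_sub_row (s := k + 1) (by omega)]
  have hprod₁ : ∏ i ∈ range (n + m + 1), (if i < n + m then 1 else T - 1) = T - 1 := by
    rw [prod_range_ite_lt, one_pow, one_mul, pow_one]
  have hprod₂ : ∏ i ∈ range (n + m + 1), (if i < k + 1 then T - 1 else 1) = (T - 1) ^ (k + 1) := by
    rw [show n + m + 1 = k + 1 + (d + 1) by omega, prod_range_ite_lt, one_pow, mul_one]
  conv_lhs => rw [← hprod₁]
  rw [← hprod₂, ← cornerDet_mul_col, ← cornerDet_mul_row]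
  refine cornerDet_congr fun i hi c hc => ?_
  have e1 : ¬ i + (k + 1) < k + 1 := by omega
  simp only [hE, borderedArray, e1, if_false, Nat.add_sub_cancel]
  by_cases h1 : i < k + 1
  · simp only [if_pos h1]
    split_ifs <;> first | omega | ring
  · simp only [if_neg h1]
    split_ifs <;> first | omega | ring

theorem map_sylvesterDesc {S : Type*} [CommRing S] (φ : R →+* S) (k p q : ℕ) (f g : R[X])
    (w : ℕ → R) (i c : ℕ) :
    φ (sylvesterDesc k p q f g w i c) =
      sylvesterDesc k p q (f.map φ) (g.map φ) (fun j => φ (w j)) i c := by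
  unfold sylvesterDesc
  split_ifs <;> simp

end Sylvester

section Specialization

theorem sresG_eq_cornerDet (k p q : ℕ) (f g : K[X]) :
    sresG (k + q) (k + p) k f g =
      cornerDet (p + q) (sylvesterDesc k p q (f.map C) (g.map C) (fun j => X ^ j)) := by
  have hp : k + p - k = p := Nat.add_sub_cancel_left _ _
  have hq : k + q - k = q := Nat.add_sub_cancel_left _ _
  have hN : p + q = (k + p - k) + (k + q - k) := by rw [hp, hq]
  conv_rhs => rw [hN]
  unfold sresG cornerDet
  congr 1
  ext1 r c
  simp only [sresMatGen, sylvesterDesc, Matrix.of_apply, coeff_map, hp, hq]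

theorem sresF_eq_cornerDet (k p q : ℕ) (f g : K[X]) :
    sresF (k + q) (k + p) k f g = (-1) ^ (p * q) *
      cornerDet (q + p) (sylvesterDesc k q p (g.map C) (f.map C) (fun j => X ^ j)) := by
  have hp : k + p - k = p := Nat.add_sub_cancel_left _ _
  have hq : k + q - k = q := Nat.add_sub_cancel_left _ _
  have hN : p + q = (k + p - k) + (k + q - k) := by rw [hp, hq]
  rw [← cornerDet_sylvesterDesc_swap]
  conv_rhs => rw [hN]
  unfold sresF cornerDet
  congr 1
  ext1 r c
  simp only [sresMatGen, Matrix.of_apply, coeff_map, hp, hq]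

/-- The sequence of constants in `K[x][T]` extending a finite list by zero. -/
noncomputable def constSeq {u : ℕ} (Γ : Fin u → K) (c : ℕ) : K[X][X] :=
  if h : c < u then C (C (Γ ⟨c, h⟩)) else 0

theorem constSeq_of_lt {u : ℕ} (Γ : Fin u → K) {c : ℕ} (h : c < u) :
    constSeq Γ c = C (C (Γ ⟨c, h⟩)) := dif_pos h

theorem cornerDet_constSeq {u : ℕ} (Γ : Fin u → K) :
    cornerDet u (fun i c => constSeq Γ c ^ i) = C (C (vand Γ)) := by
  unfold vand cornerDet
  rw [← Matrix.det_vandermonde, ← Matrix.det_transpose, RingHom.map_det, RingHom.map_det]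
  congr 1
  ext1 i j
  simp [constSeq_of_lt Γ i.2, Matrix.vandermonde_apply]

theorem det_sylvU_eq_cornerDet (k p q : ℕ) (A : Fin (k + q + 1) → K) (B : Fin (k + p + 1) → K) :
    (sylvU A B (k + p + q + 1)).det =
      cornerDet (k + p + 1 + (k + q + 1))
        (doubleSumArray k (k + p + 1) (constSeq A) (constSeq B) (C X) X) := by
  rw [add_comm (k + p + 1)]
  unfold cornerDet
  congr 1
  ext1 r c
  have hk : k + q + 1 + (k + p + 1) - (k + p + q + 1) = k + 1 := by omega
  simp only [sylvU, doubleSumArray, Matrix.of_apply, hk]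
  by_cases h : (c : ℕ) < k + p + 1
  · simp only [dif_pos h, if_pos h, constSeq_of_lt B h]
    simp only [map_pow, map_mul, map_sub]
  · have h' : (c : ℕ) - (k + p + 1) < k + q + 1 := by omega
    simp only [dif_neg h, if_neg h, constSeq_of_lt A h']
    simp only [map_pow, map_mul, map_sub]

theorem eval_constSeq_prod {u : ℕ} (Γ : Fin u → K) {c : ℕ} (h : c < u) :
    ((∏ i, (X - C (Γ i))).map ((C : K[X] →+* K[X][X]).comp C)).eval (constSeq Γ c) = 0 := by
  rw [constSeq_of_lt Γ h, Polynomial.map_prod, eval_prod]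
  exact Finset.prod_eq_zero (Finset.mem_univ ⟨c, h⟩) (by simp)

theorem eval_C_X_map (f : K[X]) :
    (f.map ((C : K[X] →+* K[X][X]).comp C)).eval (C X) = C f := by
  rw [eval_map, ← hom_eval₂, eval₂_C_X]

theorem C_cornerDet_sylvesterDesc (k p q : ℕ) (f g : K[X]) :
    C (cornerDet (p + q) (sylvesterDesc k p q (f.map C) (g.map C) (fun j => (X : K[X]) ^ j))) =
      cornerDet (p + q) (sylvesterDesc k p q (f.map ((C : K[X] →+* K[X][X]).comp C))
        (g.map ((C : K[X] →+* K[X][X]).comp C)) (fun j => C X ^ j)) := by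
  rw [cornerDet_map]
  simp only [map_sylvesterDesc, Polynomial.map_map, map_pow]

theorem neg_one_pow_swap_sign (R : Type*) [Ring R] (k p q : ℕ) :
    (-1 : R) ^ (k + 1 + (k + q + 1) * (k + p + 1)) * (-1) ^ ((k + 1) * (k + q + 1) + p) =
      -((-1) ^ (k * (k + p + 1) + (k + p + q + 1)) * (-1) ^ ((p + 1) * (q + 1))) := by
  rw [← pow_add, ← pow_add, ← neg_one_mul ((-1 : R) ^ (_ + _)), ← pow_succ']
  apply neg_one_pow_congr
  simp only [parity_simps]
  tauto

end Specialization

/-- **Theorem 7, case `m ≤ n ≤ d < m+n`**: with `d' := m+n-d` and `σ := (d'-1)n + d`,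
`u_d(x,T) = (-1)^σ·V(A)·V(B)·(F_{d'-1}f + T·G_{d'-1}g)·(T-1)^{d'-1}` in `K[x,T]`
(realized as `(K[x])[T]`, with outer variable `T`). -/
theorem det_sylvU_high {m n : ℕ} (hm : 1 ≤ m) (hn : 1 ≤ n) (hmn : m ≤ n)
    (A : Fin m → K) (B : Fin n → K) (hA : Function.Injective A) (hB : Function.Injective B)
    (f g : Polynomial K) (hf : f = ∏ i, (X - C (A i))) (hg : g = ∏ j, (X - C (B j)))
    (d : ℕ) (hnd : n ≤ d) (hdm : d < m + n) :
    (sylvU A B d).det =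
      (-1 : Polynomial (Polynomial K)) ^ ((m + n - d - 1) * n + d) *
        C (C (vand A * vand B)) *
        (C (sresF m n (m + n - d - 1) f g * f) + X * C (sresG m n (m + n - d - 1) f g * g)) *
        (X - 1) ^ (m + n - d - 1) := by
  obtain ⟨k, hk⟩ : ∃ k, k = m + n - d - 1 := ⟨_, rfl⟩
  obtain ⟨q, rfl⟩ : ∃ q, m = k + q + 1 := ⟨m - k - 1, by omega⟩
  obtain ⟨p, rfl⟩ : ∃ p, n = k + p + 1 := ⟨n - k - 1, by omega⟩
  obtain rfl : d = k + p + q + 1 := by omega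
  rw [← hk]
  set φ : K →+* K[X][X] := (C : K[X] →+* K[X][X]).comp C
  have hfm : f.Monic := hf ▸ monic_prod_of_monic _ _ fun i _ => monic_X_sub_C _
  have hgm : g.Monic := hg ▸ monic_prod_of_monic _ _ fun i _ => monic_X_sub_C _
  have hfd : (f.map φ).natDegree = k + q + 1 := by
    rw [hfm.natDegree_map, hf, natDegree_finsetProd_X_sub_C_eq_card]
    simp
  have hgd : (g.map φ).natDegree = k + p + 1 := by
    rw [hgm.natDegree_map, hg, natDegree_finsetProd_X_sub_C_eq_card]
    simp
  have ha : ∀ c < k + q + 1, (f.map φ).eval (constSeq A c) = 0 := fun c hc =>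
    hf ▸ eval_constSeq_prod A hc
  have hb : ∀ c < k + p + 1, (g.map φ).eval (constSeq B c) = 0 := fun c hc =>
    hg ▸ eval_constSeq_prod B hc
  have hG := cornerDet_vandermondePair k p q (f.map φ) (g.map φ) (constSeq A) (constSeq B) (C X)
    hfd (hfm.map φ) hgd (hgm.map φ) ha hb
  have hF := cornerDet_vandermondePair k q p (g.map φ) (f.map φ) (constSeq B) (constSeq A) (C X)
    hgd (hgm.map φ) hfd (hfm.map φ) hb ha
  rw [cornerDet_constSeq, cornerDet_constSeq, eval_C_X_map, ← C_cornerDet_sylvesterDesc] at hG hF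
  have hU := cornerDet_doubleSumArray_mul (k := k) (n := k + p + 1) (m := k + q + 1)
    (d := k + p + q + 1) (by omega) (by omega) (constSeq A) (constSeq B) (C X) X
  rw [← det_sylvU_eq_cornerDet, hG, hF] at hU
  have hX : (X - 1 : K[X][X]) ≠ 0 := X_sub_C_ne_zero 1
  apply mul_left_cancel₀ hX
  have hG' : sresG (k + q + 1) (k + p + 1) k f g = cornerDet (p + 1 + (q + 1))
      (sylvesterDesc k (p + 1) (q + 1) (f.map C) (g.map C) fun j => X ^ j) :=
    sresG_eq_cornerDet k (p + 1) (q + 1) f g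
  have hF' : sresF (k + q + 1) (k + p + 1) k f g = (-1) ^ ((p + 1) * (q + 1)) *
      cornerDet (q + 1 + (p + 1))
        (sylvesterDesc k (q + 1) (p + 1) (g.map C) (f.map C) fun j => X ^ j) :=
    sresF_eq_cornerDet k (p + 1) (q + 1) f g
  rw [hU, hG', hF']
  have e₁ : (-1 : K[X][X]) ^ ((k + 1) * (k + p + 1) + q) =
      (-1) ^ (k * (k + p + 1) + (k + p + q + 1)) := by
    congr 1
    ring
  have e₂ := neg_one_pow_swap_sign K[X][X] k p q
  rw [e₁]
  simp only [map_mul, map_pow, map_neg, map_one]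
  set F := C (cornerDet (q + 1 + (p + 1)) (sylvesterDesc k (q + 1) (p + 1) (g.map C) (f.map C)
    fun j => (X : K[X]) ^ j))
  linear_combination (-(X - 1) ^ (k + 1) * C (C (vand A)) * C (C (vand B)) * F * C f) * e₂
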